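/- Let G = {1,2}, let I_2 be the 2×2 identity matrix and J_2 the 2×2 swap matrix (J_2(1,2) = J_2(2,1) = 1, J_2(1,1) = J_2(2,2) = 0). Let p be an imitation kernel with gcd(A) = 1 and with P_(k) ∈ {I_2, J_2} for every k ∈ A. Then 𝒢(p) has exactly one element if and only if either there exists an even m ∈ A with P_(m) = J_2, or there exist m_1, m_2 ∈ A both odd with P_(m_1) = J_2 and P_(m_2) = I_2. -/

import Mathlib

open MeasureTheory
open scoped BigOperators

/-- The matrix of a word `𝐚 = (a_1, …, a_n)` (encoded as a list `[a_1, …, a_n]`),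
namely `P_𝐚 = P_(a_n) ⋯ P_(a_1)`, so that `wordK P l i j` is the `(i,j)` entry. -/
noncomputable def wordK {G : Type*} [Fintype G] [DecidableEq G]
    (P : ℕ → G → G → ℝ) : List ℕ → G → G → ℝ
  | [] => fun i j => if i = j then 1 else 0
  | a :: l => fun i j => ∑ m, wordK P l i m * P a m j

/-- A word over the alphabet `A`: a nonempty finite tuple with entries in `A`. -/
def IsWord (A : Set ℕ) (l : List ℕ) : Prop := l ≠ [] ∧ ∀ a ∈ l, a ∈ A

/-- `i` communicates with `j` if `P_𝐚(i,j) > 0` for some word `𝐚`. -/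
def Communicates {G : Type*} [Fintype G] [DecidableEq G]
    (A : Set ℕ) (P : ℕ → G → G → ℝ) (i j : G) : Prop :=
  ∃ l : List ℕ, IsWord A l ∧ 0 < wordK P l i j

/-- `i` and `j` intercommunicate (every state intercommunicates with itself). -/
def Intercommunicates {G : Type*} [Fintype G] [DecidableEq G]
    (A : Set ℕ) (P : ℕ → G → G → ℝ) (i j : G) : Prop :=
  i = j ∨ (Communicates A P i j ∧ Communicates A P j i)

/-- An intercommunicating class: an equivalence class of the intercommunication relation. -/
def IsInterClass {G : Type*} [Fintype G] [DecidableEq G]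
    (A : Set ℕ) (P : ℕ → G → G → ℝ) (C : Set G) : Prop :=
  ∃ i : G, C = {j | Intercommunicates A P i j}

/-- A set `C` is closed if whenever `i ∈ C` communicates with `j`, then `j ∈ C`. -/
def IsClosedClass {G : Type*} [Fintype G] [DecidableEq G]
    (A : Set ℕ) (P : ℕ → G → G → ℝ) (C : Set G) : Prop :=
  ∀ i ∈ C, ∀ j : G, Communicates A P i j → j ∈ C

/-- `d` is the greatest common divisor of the set `S ⊆ ℕ`. -/
def IsGCDOfSet (S : Set ℕ) (d : ℕ) : Prop :=
  (∀ n ∈ S, d ∣ n) ∧ ∀ e : ℕ, (∀ n ∈ S, e ∣ n) → e ∣ d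

/-- The set of depths `s(𝐚)` of words `𝐚` with `P_𝐚(i,i) > 0`. -/
def ReturnDepths {G : Type*} [Fintype G] [DecidableEq G]
    (A : Set ℕ) (P : ℕ → G → G → ℝ) (i : G) : Set ℕ :=
  {s | ∃ l : List ℕ, IsWord A l ∧ 0 < wordK P l i i ∧ l.sum = s}

/-- `E` is measurable with respect to the coordinates `(x_m)_{m < n}`. -/
def PastMeasurable {G : Type*} [MeasurableSpace G] (n : ℤ) (E : Set (ℤ → G)) : Prop :=
  MeasurableSet[MeasurableSpace.comap
    (fun x : ℤ → G => fun m : {m : ℤ // m < n} => x m.1) MeasurableSpace.pi] E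

/-- `μ` is compatible with the imitation kernel
`p(g | w_{-1}, w_{-2}, …) = ∑_{k ∈ A} θ_k P_(k)(w_{-k}, g)` (here `θ` vanishes off `A`). -/
def Compatible {G : Type*} [MeasurableSpace G] (θ : ℕ → ℝ) (P : ℕ → G → G → ℝ)
    (μ : Measure (ℤ → G)) : Prop :=
  ∀ (n : ℤ) (g : G) (E : Set (ℤ → G)), PastMeasurable n E →
    (μ (E ∩ {x | x n = g})).toReal
      = ∫ x in E, (∑' k : ℕ, θ k * P k (x (n - (k : ℤ))) g) ∂μ

theorem exists_add_of_mem_closure {A : Set ℕ} {d : ℕ} (hd : d ∈ AddSubmonoid.closure A)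
    (h0 : d ≠ 0) : ∃ k ∈ A, ∃ e ∈ AddSubmonoid.closure A, d = k + e := by
  induction hd using AddSubmonoid.closure_induction with
  | mem x hx => exact ⟨x, hx, 0, zero_mem _, rfl⟩
  | zero => exact absurd rfl h0
  | add x y hx hy ihx ihy =>
    by_cases hx0 : x = 0
    · subst hx0
      obtain ⟨k, hk, e, he, h⟩ := ihy (by simpa using h0)
      exact ⟨k, hk, e, he, by omega⟩
    · obtain ⟨k, hk, e, he, h⟩ := ihx hx0
      exact ⟨k, hk, e + y, add_mem he hy, by omega⟩

theorem exists_pos_lower_bound {A : Set ℕ} {θ : ℕ → ℝ} (hθ : ∀ k ∈ A, 0 < θ k) (D : ℕ) :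
    ∃ q : ℝ, 0 < q ∧ q ≤ 1 ∧ ∀ k ∈ A, k ≤ D → q ≤ θ k := by
  induction D with
  | zero =>
    by_cases h : 0 ∈ A
    · refine ⟨min 1 (θ 0), lt_min one_pos (hθ 0 h), min_le_left _ _, fun k _ hk => ?_⟩
      rw [Nat.le_zero.mp hk]; exact min_le_right _ _
    · refine ⟨1, one_pos, le_rfl, fun k hkA hk => ?_⟩
      rw [Nat.le_zero.mp hk] at hkA; exact absurd hkA h
  | succ D ih =>
    obtain ⟨q, hq, hq1, hqk⟩ := ih
    by_cases h : D + 1 ∈ A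
    · refine ⟨min q (θ (D + 1)), lt_min hq (hθ _ h), (min_le_left _ _).trans hq1,
        fun k hkA hk => ?_⟩
      rcases Nat.lt_or_ge k (D + 1) with hlt | hge
      · exact (min_le_left _ _).trans (hqk k hkA (by omega))
      · rw [show k = D + 1 by omega]; exact min_le_right _ _
    · refine ⟨q, hq, hq1, fun k hkA hk => hqk k hkA ?_⟩
      rcases Nat.lt_or_ge k (D + 1) with hlt | hge
      · omega
      · exact absurd ((show k = D + 1 by omega) ▸ hkA) h

/-- The moment relation at time `n`: the top point `n` of a finite set of times jumps down by `k`
with weight `a k`, annihilating with any point it lands on. -/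
def MomentRelation (a : ℕ → ℝ) (h : Finset ℤ → ℝ) (n : ℤ) : Prop :=
  ∀ T : Finset ℤ, (∀ t ∈ T, t < n) →
    HasSum (fun k : ℕ => a k * h (symmDiff T {n - (k : ℤ)})) (h (insert n T))

theorem symmDiff_singleton_of_mem {ι : Type*} [DecidableEq ι] {T : Finset ι} {m : ι} (hm : m ∈ T) :
    symmDiff T {m} = T.erase m := by
  ext x; simp only [Finset.mem_symmDiff, Finset.mem_singleton, Finset.mem_erase]
  grind

theorem symmDiff_singleton_of_notMem {ι : Type*} [DecidableEq ι] {T : Finset ι} {m : ι}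
    (hm : m ∉ T) :
    symmDiff T {m} = insert m T := by
  ext x; simp only [Finset.mem_symmDiff, Finset.mem_singleton, Finset.mem_insert]
  grind

section Contraction

variable {A : Set ℕ} {θ ε : ℕ → ℝ} {h : Finset ℤ → ℝ} {M : ℝ} {r : ℕ}

theorem abs_weight (hθnn : ∀ k, 0 ≤ θ k) (hε : ∀ k, ε k = 1 ∨ ε k = -1) (k : ℕ) :
    |θ k * ε k| = θ k := by
  rw [abs_mul, abs_of_nonneg (hθnn k)]
  rcases hε k with e | e <;> simp [e]

theorem abs_sub_jump_le (hθnn : ∀ k, 0 ≤ θ k) (hθsum : HasSum θ 1)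
    (hε : ∀ k, ε k = 1 ∨ ε k = -1)
    (hrel : ∀ n, MomentRelation (fun k => θ k * ε k) h n)
    (hlt : ∀ S : Finset ℤ, S.card < r → h S = 0)
    (hM0 : 0 ≤ M) (hM : ∀ S : Finset ℤ, S.card = r → |h S| ≤ M)
    {T : Finset ℤ} {n : ℤ} (hT : ∀ t ∈ T, t < n) (hcard : T.card + 1 = r) (k : ℕ) :
    |h (insert n T) - θ k * ε k * h (symmDiff T {n - (k : ℤ)})| ≤ (1 - θ k) * M := by
  have hb : ∀ j : ℕ, |h (symmDiff T {n - (j : ℤ)})| ≤ M := by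
    intro j
    by_cases hm : n - (j : ℤ) ∈ T
    · rw [symmDiff_singleton_of_mem hm, hlt _ (by rw [Finset.card_erase_of_mem hm]; omega)]
      simpa using hM0
    · rw [symmDiff_singleton_of_notMem hm]
      exact hM _ (by rw [Finset.card_insert_of_notMem hm]; exact hcard)
  have h1 := (hrel n T hT).sub
    (hasSum_pi_single k (θ k * ε k * h (symmDiff T {n - (k : ℤ)})))
  have h2 := (hθsum.sub (hasSum_pi_single k (θ k))).mul_right M
  refine h1.norm_le_of_bounded h2 fun j => ?_
  by_cases hj : j = k
  · subst hj; simp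
  · simp only [Pi.single_apply, if_neg hj, sub_zero, Real.norm_eq_abs, abs_mul]
    rw [abs_of_nonneg (hθnn j)]
    have : |ε j| = 1 := by rcases hε j with e | e <;> simp [e]
    rw [this, mul_one]
    exact mul_le_mul_of_nonneg_left (hb j) (hθnn j)

theorem abs_sub_iterate_jump_le (hApos : ∀ k ∈ A, 0 < k)
    (hθnn : ∀ k, 0 ≤ θ k) (hθsum : HasSum θ 1)
    (hε : ∀ k, ε k = 1 ∨ ε k = -1)
    (hrel : ∀ n, MomentRelation (fun k => θ k * ε k) h n)
    (hlt : ∀ S : Finset ℤ, S.card < r → h S = 0)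
    (hM0 : 0 ≤ M) (hM : ∀ S : Finset ℤ, S.card = r → |h S| ≤ M)
    {T : Finset ℤ} {c : ℤ} (hT : ∀ t ∈ T, t < c) (hcard : T.card + 1 = r)
    {k : ℕ} (hk : k ∈ A) (j : ℕ) :
    |h (insert (c + (k * j : ℕ)) T) - θ k ^ j * ε k ^ j * h (insert c T)|
      ≤ (1 - θ k ^ j) * M := by
  induction j with
  | zero => simp
  | succ j ih =>
    have hk0 := hApos k hk
    have h1 := abs_sub_jump_le hθnn hθsum hε hrel hlt hM0 hM (T := T) (n := c + (k * (j + 1) : ℕ))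
      (fun t ht => by have := hT t ht; omega) hcard k
    have e1 : c + ((k * (j + 1) : ℕ) : ℤ) - (k : ℤ) = c + ((k * j : ℕ) : ℤ) := by
      push_cast; ring
    rw [e1, symmDiff_singleton_of_notMem (fun hm => by have := hT _ hm; omega)] at h1
    set x := h (insert (c + ((k * (j + 1) : ℕ) : ℤ)) T)
    set y := h (insert (c + ((k * j : ℕ) : ℤ)) T)
    set z := h (insert c T)
    have e2 : x - θ k ^ (j + 1) * ε k ^ (j + 1) * z =
      (x - θ k * ε k * y) + θ k * ε k * (y - θ k ^ j * ε k ^ j * z) := by ring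
    have habs : |θ k * ε k| = θ k := abs_weight hθnn hε k
    rw [e2]
    calc _ ≤ |x - θ k * ε k * y| + |θ k * ε k * (y - θ k ^ j * ε k ^ j * z)| := abs_add_le _ _
      _ ≤ (1 - θ k) * M + θ k * ((1 - θ k ^ j) * M) := by
        rw [abs_mul (θ k * ε k), habs]
        exact add_le_add h1 (mul_le_mul_of_nonneg_left ih (hθnn k))
      _ = _ := by ring

/-- If every point above the level `c` can jump down to `c` and there are at least two such points,
then a collision occurs with
positive probability, which bounds `|h S|` away from `M`. -/
theorem abs_le_of_collision (hApos : ∀ k ∈ A, 0 < k)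
    (hθnn : ∀ k, 0 ≤ θ k) (hθsum : HasSum θ 1)
    (hε : ∀ k, ε k = 1 ∨ ε k = -1)
    (hrel : ∀ n, MomentRelation (fun k => θ k * ε k) h n)
    (hlt : ∀ S : Finset ℤ, S.card < r → h S = 0)
    (hM0 : 0 ≤ M) (hM : ∀ S : Finset ℤ, S.card = r → |h S| ≤ M)
    {q : ℝ} (hq0 : 0 < q) (hq1 : q ≤ 1) {D : ℕ} (hq : ∀ k ∈ A, k ≤ D → q ≤ θ k) (c : ℤ)
    (n : ℕ) (S : Finset ℤ) (hcard : S.card = r)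
    (hreach : ∀ s ∈ S, c ≤ s → ∃ d ∈ AddSubmonoid.closure A, s = c + (d : ℤ))
    (htwo : ∃ s ∈ S, ∃ t ∈ S, s < t ∧ c ≤ s)
    (hD : ∀ s ∈ S, s ≤ c + D) (hn : ∑ s ∈ S, (s - c).toNat ≤ n) :
    |h S| ≤ (1 - q ^ n) * M := by
  induction n generalizing S with
  | zero =>
    obtain ⟨s, hs, t, ht, hst, hcs⟩ := htwo
    have := Finset.single_le_sum (f := fun s : ℤ => (s - c).toNat) (fun _ _ => Nat.zero_le _) ht
    omega
  | succ n ih =>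
    obtain ⟨s, hs, t, ht, hst, hcs⟩ := htwo
    have hne : S.Nonempty := ⟨s, hs⟩
    obtain ⟨m, hmdef⟩ : ∃ m, m = S.max' hne := ⟨_, rfl⟩
    have hmS : m ∈ S := hmdef ▸ S.max'_mem hne
    have hmax : ∀ x ∈ S, x ≤ m := fun x hx => hmdef ▸ S.le_max' x hx
    have hTlt : ∀ x ∈ S.erase m, x < m := fun x hx =>
      lt_of_le_of_ne (hmax x (Finset.mem_of_mem_erase hx)) (Finset.ne_of_mem_erase hx)
    have hcm : c < m := by have := hmax t ht; omega
    obtain ⟨d, hd, hmd⟩ := hreach m hmS hcm.le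
    obtain ⟨k, hk, e, he, hde⟩ := exists_add_of_mem_closure hd (by omega)
    have hk0 := hApos k hk
    have hcardT : (S.erase m).card + 1 = r := by
      rw [Finset.card_erase_of_mem hmS]
      have := Finset.card_pos.mpr hne
      omega
    have hkD : q ≤ θ k := hq k hk (by have := hD m hmS; omega)
    have hjump := abs_sub_jump_le hθnn hθsum hε hrel hlt hM0 hM hTlt hcardT k
    rw [Finset.insert_erase hmS] at hjump
    have hθ1 : θ k ≤ 1 := by
      have := hθsum.summable.le_tsum k (fun j _ => hθnn j)
      rwa [hθsum.tsum_eq] at this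
    have hqn : q ^ n ≤ 1 := pow_le_one₀ hq0.le hq1
    have hqn0 : 0 < q ^ n := pow_pos hq0 n
    have hqs : q ^ (n + 1) ≤ θ k * q ^ n := by
      rw [pow_succ, mul_comm]; exact mul_le_mul_of_nonneg_right hkD hqn0.le
    have habs : |θ k * ε k| = θ k := abs_weight hθnn hε k
    have hmain : |h (symmDiff (S.erase m) {m - (k : ℤ)})| ≤ (1 - q ^ n) * M := by
      by_cases hcol : m - (k : ℤ) ∈ S.erase m
      · rw [symmDiff_singleton_of_mem hcol, hlt _ (by
          rw [Finset.card_erase_of_mem hcol]; omega), abs_zero]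
        exact mul_nonneg (by linarith) hM0
      · rw [symmDiff_singleton_of_notMem hcol]
        have hmk : m - (k : ℤ) = c + (e : ℤ) := by omega
        have hsT : s ∈ S.erase m :=
          Finset.mem_erase.mpr ⟨by have := hmax t ht; omega, hs⟩
        refine ih _ (by rw [Finset.card_insert_of_notMem hcol]; exact hcardT) ?_ ?_ ?_ ?_
        · intro x hx hcx
          rcases Finset.mem_insert.mp hx with rfl | hx
          · exact ⟨e, he, hmk⟩
          · exact hreach x (Finset.mem_of_mem_erase hx) hcx
        · rcases lt_trichotomy s (m - (k : ℤ)) with hl | hl | hl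
          · exact ⟨s, Finset.mem_insert_of_mem hsT, _, Finset.mem_insert_self _ _, hl, hcs⟩
          · exact absurd (hl ▸ hsT) hcol
          · exact ⟨_, Finset.mem_insert_self _ _, s, Finset.mem_insert_of_mem hsT, hl, by omega⟩
        · intro x hx
          rcases Finset.mem_insert.mp hx with rfl | hx
          · have := hD m hmS; omega
          · exact hD x (Finset.mem_of_mem_erase hx)
        · rw [Finset.sum_insert hcol]
          have := Finset.add_sum_erase S (fun s : ℤ => (s - c).toNat) hmS
          omega
    have : |h S| ≤ (1 - θ k) * M + θ k * ((1 - q ^ n) * M) := by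
      set y := h (symmDiff (S.erase m) {m - (k : ℤ)})
      calc |h S| = |(h S - θ k * ε k * y) + θ k * ε k * y| := by ring_nf
        _ ≤ |h S - θ k * ε k * y| + |θ k * ε k * y| := abs_add_le _ _
        _ ≤ _ := by
          rw [abs_mul (θ k * ε k), habs]
          exact add_le_add hjump (mul_le_mul_of_nonneg_left hmain (hθnn k))
    nlinarith [mul_le_mul_of_nonneg_right hqs hM0]

/-- There is a level below `b` such that all points of `S` above it are at distance at least
`N` from it. -/
theorem exists_level (S : Finset ℤ) (b : ℤ) {N : ℕ} (hN : 0 < N) :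
    ∃ c : ℤ, c ≤ b ∧ b ≤ c + N * (S.card + 2) ∧ ∀ s ∈ S, c ≤ s → c + N ≤ s := by
  have : ∃ i ∈ Finset.Icc (1 : ℤ) (S.card + 1), i ∉ S.image (fun s => (b - s) / (N : ℤ)) := by
    apply Finset.exists_mem_notMem_of_card_lt_card
    have := Finset.card_image_le (s := S) (f := fun s => (b - s) / (N : ℤ))
    rw [Int.card_Icc]
    omega
  obtain ⟨i, hi, hiS⟩ := this
  rw [Finset.mem_Icc] at hi
  have hN' : (0 : ℤ) < N := by exact_mod_cast hN
  refine ⟨b - N * (i + 1) + 1, by nlinarith, by nlinarith, fun s hs hcs => ?_⟩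
  have h1 : (b - s) / (N : ℤ) < i + 1 := by
    rw [Int.ediv_lt_iff_lt_mul hN']; nlinarith
  have h2 : (b - s) / (N : ℤ) ≠ i := fun h => hiS (Finset.mem_image.mpr ⟨s, hs, h⟩)
  have h3 : (b - s) / (N : ℤ) < i := by omega
  rw [Int.ediv_lt_iff_lt_mul hN'] at h3
  nlinarith

theorem exists_contraction (hApos : ∀ k ∈ A, 0 < k)
    (hθpos : ∀ k ∈ A, 0 < θ k) (hθnn : ∀ k, 0 ≤ θ k) (hθsum : HasSum θ 1)
    (hε : ∀ k, ε k = 1 ∨ ε k = -1) {N : ℕ} (hN : ∀ m ≥ N, m ∈ AddSubmonoid.closure A)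
    {k k' j j' : ℕ} (hk : k ∈ A) (hk' : k' ∈ A) (hkj : k * j = k' * j')
    (hεk : ε k ^ j = 1) (hεk' : ε k' ^ j' = -1)
    (hrel : ∀ n, MomentRelation (fun k => θ k * ε k) h n)
    (hr : 0 < r) (hlt : ∀ S : Finset ℤ, S.card < r → h S = 0) :
    ∃ ρ : ℝ, 0 ≤ ρ ∧ ρ < 1 ∧ ∀ M : ℝ, 0 ≤ M → (∀ S : Finset ℤ, S.card = r → |h S| ≤ M) →
      ∀ S : Finset ℤ, S.card = r → |h S| ≤ ρ * M := by
  have hN' : ∀ m ≥ N + 1, m ∈ AddSubmonoid.closure A := fun m hm => hN m (by omega)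
  set D : ℕ := k * j + (N + 1) * (r + 2) with hDdef
  obtain ⟨q, hq0, hq1, hq⟩ := exists_pos_lower_bound hθpos D
  have hθ1 : ∀ k, θ k ≤ 1 := fun k => by
    have := hθsum.summable.le_tsum k (fun j _ => hθnn j)
    rwa [hθsum.tsum_eq] at this
  set δ : ℝ := min (q ^ (r * D)) (min (θ k ^ j) (θ k' ^ j')) with hδ
  have hδ0 : 0 < δ :=
    lt_min (pow_pos hq0 _) (lt_min (pow_pos (hθpos k hk) _) (pow_pos (hθpos k' hk') _))
  have hδ1 : δ ≤ q ^ (r * D) := min_le_left _ _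
  have hδ2 : δ ≤ θ k ^ j := (min_le_right _ _).trans (min_le_left _ _)
  have hδ3 : δ ≤ θ k' ^ j' := (min_le_right _ _).trans (min_le_right _ _)
  have hδle : δ ≤ 1 := hδ1.trans (pow_le_one₀ hq0.le hq1)
  refine ⟨1 - δ, by linarith, by linarith, fun M hM0 hM S hS => ?_⟩
  have hne : S.Nonempty := Finset.card_pos.mp (by omega)
  obtain ⟨m, hmdef⟩ : ∃ m, m = S.max' hne := ⟨_, rfl⟩
  have hmS : m ∈ S := hmdef ▸ S.max'_mem hne
  have hmax : ∀ x ∈ S, x ≤ m := fun x hx => hmdef ▸ S.le_max' x hx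
  by_cases hgap : ∀ t ∈ S.erase m, t < m - (k * j : ℕ)
  · have hcardT : (S.erase m).card + 1 = r := by
      rw [Finset.card_erase_of_mem hmS]; omega
    have h1 := abs_sub_iterate_jump_le hApos hθnn hθsum hε hrel hlt hM0 hM hgap hcardT hk j
    have h2 := abs_sub_iterate_jump_le hApos hθnn hθsum hε hrel hlt hM0 hM hgap hcardT hk' j'
    rw [← hkj] at h2
    rw [sub_add_cancel, Finset.insert_erase hmS] at h1 h2
    rw [hεk] at h1
    rw [hεk'] at h2
    set y := h (insert (m - ((k * j : ℕ) : ℤ)) (S.erase m))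
    rw [abs_le] at h1 h2 ⊢
    have p1 := mul_le_mul_of_nonneg_right hδ2 hM0
    have p2 := mul_le_mul_of_nonneg_right hδ3 hM0
    rcases le_total 0 y with hy | hy
    · have y1 := mul_nonneg (hδ0.le.trans hδ2) hy
      have y2 := mul_nonneg (hδ0.le.trans hδ3) hy
      constructor <;> nlinarith
    · have y1 := mul_nonpos_of_nonneg_of_nonpos (hδ0.le.trans hδ2) hy
      have y2 := mul_nonpos_of_nonneg_of_nonpos (hδ0.le.trans hδ3) hy
      constructor <;> nlinarith
  · push Not at hgap
    obtain ⟨b, hb, hbm⟩ := hgap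
    obtain ⟨hbm', hbS⟩ := Finset.mem_erase.mp hb
    obtain ⟨c, hcb, hbc, hc⟩ := exists_level S b (Nat.succ_pos N)
    have hbc' : b ≤ c + (((N + 1) * (r + 2) : ℕ) : ℤ) := by
      rw [hS] at hbc; push_cast at hbc ⊢; exact hbc
    have hD : ∀ s ∈ S, s ≤ c + (D : ℤ) := fun s hs => by
      have := hmax s hs
      omega
    have := abs_le_of_collision hApos hθnn hθsum hε hrel hlt hM0 hM hq0 hq1 hq c (r * D) S hS
      (fun s hs hcs => ⟨(s - c).toNat, hN' _ (by have := hc s hs hcs; omega), by omega⟩)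
      ⟨b, hbS, m, hmS, lt_of_le_of_ne (hmax b hbS) hbm', hcb⟩ hD (by
        rw [← hS]
        calc _ ≤ ∑ s ∈ S, D := Finset.sum_le_sum fun s hs => by have := hD s hs; omega
          _ = _ := by simp)
    exact this.trans (mul_le_mul_of_nonneg_right (by linarith) hM0)

end Contraction

theorem eq_zero_of_momentRelation {A : Set ℕ} {θ ε : ℕ → ℝ} {h : Finset ℤ → ℝ}
    (hApos : ∀ k ∈ A, 0 < k)
    (hθpos : ∀ k ∈ A, 0 < θ k) (hθnn : ∀ k, 0 ≤ θ k) (hθsum : HasSum θ 1)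
    (hε : ∀ k, ε k = 1 ∨ ε k = -1) {N : ℕ} (hN : ∀ m ≥ N, m ∈ AddSubmonoid.closure A)
    {k k' j j' : ℕ} (hk : k ∈ A) (hk' : k' ∈ A) (hkj : k * j = k' * j')
    (hεk : ε k ^ j = 1) (hεk' : ε k' ^ j' = -1)
    (hrel : ∀ n, MomentRelation (fun k => θ k * ε k) h n)
    (h0 : h ∅ = 0) {B : ℝ} (hB : ∀ S, |h S| ≤ B) (S : Finset ℤ) : h S = 0 := by
  obtain ⟨r, hr⟩ : ∃ r, r = S.card := ⟨_, rfl⟩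
  induction r using Nat.strong_induction_on generalizing S with
  | _ r ih =>
    rcases Nat.eq_zero_or_pos r with rfl | hr0
    · rw [Finset.card_eq_zero.mp hr.symm, h0]
    · obtain ⟨ρ, hρ0, hρ1, hρ⟩ := exists_contraction hApos hθpos hθnn hθsum hε hN hk hk' hkj
        hεk hεk' hrel hr0 (fun S hS => ih _ hS S rfl)
      have hB0 : 0 ≤ B := (abs_nonneg _).trans (hB ∅)
      have key : ∀ i : ℕ, ∀ S : Finset ℤ, S.card = r → |h S| ≤ ρ ^ i * B := by
        intro i
        induction i with
        | zero => intro S _; simpa using hB S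
        | succ i ihi =>
          intro S hS
          have := hρ _ (mul_nonneg (pow_nonneg hρ0 i) hB0) ihi S hS
          rwa [← mul_assoc, ← pow_succ'] at this
      have hlim : Filter.Tendsto (fun i : ℕ => ρ ^ i * B) Filter.atTop (nhds 0) := by
        simpa using (tendsto_pow_atTop_nhds_zero_of_lt_one hρ0 hρ1).mul_const B
      exact abs_nonpos_iff.mp (ge_of_tendsto' hlim fun i => key i S hr.symm)

/-- The `±1` encoding of a binary spin. -/
def spin (i : Fin 2) : ℝ := if i = 0 then 1 else -1

theorem spin_mul_self (i : Fin 2) : spin i * spin i = 1 := by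
  unfold spin; split_ifs <;> norm_num

theorem abs_spin (i : Fin 2) : |spin i| = 1 := by
  unfold spin; split_ifs <;> norm_num

/-- The character of `ι → Fin 2` associated with a finite set of coordinates. -/
def character {ι : Type*} (S : Finset ι) (x : ι → Fin 2) : ℝ := ∏ s ∈ S, spin (x s)

theorem abs_character {ι : Type*} (S : Finset ι) (x : ι → Fin 2) : |character S x| = 1 := by
  simp [character, Finset.abs_prod, abs_spin]

theorem character_eq_or {ι : Type*} (S : Finset ι) (x : ι → Fin 2) :
    character S x = 1 ∨ character S x = -1 :=
  eq_or_eq_neg_of_abs_eq (abs_character S x)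

theorem continuous_spin : Continuous spin := continuous_of_discreteTopology

theorem continuous_character {ι : Type*} (S : Finset ι) :
    Continuous (character S : (ι → Fin 2) → ℝ) :=
  continuous_finsetProd _ fun s _ => continuous_spin.comp (continuous_apply s)

theorem measurable_spin : Measurable spin := measurable_of_finite _

theorem measurable_character {ι : Type*} (S : Finset ι) :
    Measurable (character S : (ι → Fin 2) → ℝ) :=
  Finset.measurable_fun_prod _ fun s _ => measurable_spin.comp (measurable_pi_apply s)

theorem integrable_character {ι : Type*} (S : Finset ι) (μ : Measure (ι → Fin 2))
    [IsFiniteMeasure μ] : Integrable (character S) μ :=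
  Integrable.of_bound (measurable_character S).aestronglyMeasurable 1
    (Filter.Eventually.of_forall fun x => by simp [abs_character])

theorem abs_integral_character_le {ι : Type*} (S : Finset ι) (μ : Measure (ι → Fin 2))
    [IsProbabilityMeasure μ] : |∫ x, character S x ∂μ| ≤ 1 := by
  have := norm_integral_le_of_norm_le_const (μ := μ) (f := character S) (C := 1)
    (Filter.Eventually.of_forall fun x => by simp [abs_character])
  simpa using this

theorem character_mul_spin {ι : Type*} [DecidableEq ι] (T : Finset ι) (m : ι) (x : ι → Fin 2) :
    character T x * spin (x m) = character (symmDiff T {m}) x := by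
  by_cases hm : m ∈ T
  · rw [symmDiff_singleton_of_mem hm, character, ← Finset.mul_prod_erase T _ hm, character, mul_comm, ← mul_assoc,
      spin_mul_self, one_mul]
  · rw [symmDiff_singleton_of_notMem hm, character, character, Finset.prod_insert hm, mul_comm]

theorem character_insert {ι : Type*} [DecidableEq ι] {T : Finset ι} {m : ι} (hm : m ∉ T)
    (x : ι → Fin 2) : character (insert m T) x = character T x * spin (x m) := by
  rw [character, Finset.prod_insert hm, mul_comm, character]

theorem prod_indicator_eq_sum_character {ι : Type*} (I : Finset ι) (g x : ι → Fin 2) :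
    (if ∀ i ∈ I, x i = g i then (1 : ℝ) else 0)
      = (1 / 2) ^ I.card * ∑ S ∈ I.powerset, character S g * character S x := by
  have h1 : ∀ i, (1 / 2 : ℝ) * (1 + spin (g i) * spin (x i)) = if x i = g i then 1 else 0 := by
    intro i
    generalize g i = u
    generalize x i = v
    fin_cases u <;> fin_cases v <;> norm_num [spin]
  have h2 : ∑ S ∈ I.powerset, character S g * character S x
      = ∏ i ∈ I, (1 + spin (g i) * spin (x i)) := by
    rw [Finset.prod_one_add]
    exact Finset.sum_congr rfl fun S _ => by simp [character, Finset.prod_mul_distrib]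
  rw [h2, ← Finset.prod_const, ← Finset.prod_mul_distrib, Finset.prod_congr rfl fun i _ => h1 i,
    Finset.prod_ite_zero]
  simp

/-- Finite measures on `ι → Fin 2` are determined by the integrals of characters. -/
theorem measure_ext_of_integral_character {ι : Type*} {μ ν : Measure (ι → Fin 2)}
    [IsFiniteMeasure μ] [IsFiniteMeasure ν]
    (h : ∀ S : Finset ι, ∫ x, character S x ∂μ = ∫ x, character S x ∂ν) : μ = ν := by
  classical
  refine IsProjectiveLimit.unique (P := fun I : Finset ι => ν.map I.restrict) ?_ fun I => rfl
  intro I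
  refine Measure.ext_of_singleton fun y => ?_
  have hmeas : Measurable (I.restrict : (ι → Fin 2) → (I → Fin 2)) := I.measurable_restrict
  let g : ι → Fin 2 := fun i => if hi : i ∈ I then y ⟨i, hi⟩ else 0
  have hset : (I.restrict ⁻¹' {y} : Set (ι → Fin 2)) = {x | ∀ i ∈ I, x i = g i} := by
    ext x
    simp only [Set.mem_preimage, Set.mem_singleton_iff, Set.mem_ofPred_eq, funext_iff]
    constructor
    · intro hx i hi
      simp only [g, dif_pos hi, ← hx]; rfl
    · rintro hx ⟨i, hi⟩
      have := hx i hi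
      simp only [g, dif_pos hi] at this
      exact this
  have hE : MeasurableSet {x : ι → Fin 2 | ∀ i ∈ I, x i = g i} :=
    hset ▸ hmeas (measurableSet_singleton y)
  have key : ∀ ρ : Measure (ι → Fin 2), IsFiniteMeasure ρ →
      ρ.real {x | ∀ i ∈ I, x i = g i}
        = (1 / 2) ^ I.card * ∑ S ∈ I.powerset, character S g * ∫ x, character S x ∂ρ := by
    intro ρ _
    rw [← integral_indicator_one hE]
    have : (Set.indicator {x : ι → Fin 2 | ∀ i ∈ I, x i = g i} 1 : (ι → Fin 2) → ℝ)
        = fun x => (1 / 2) ^ I.card * ∑ S ∈ I.powerset, character S g * character S x := by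
      ext x
      rw [← prod_indicator_eq_sum_character, Set.indicator_apply]
      simp
    rw [this, integral_const_mul,
      integral_finsetSum _ fun S _ => (integrable_character S ρ).const_mul _]
    simp_rw [integral_const_mul]
  rw [Measure.map_apply hmeas (measurableSet_singleton y),
    Measure.map_apply hmeas (measurableSet_singleton y), hset]
  have := (key μ inferInstance).trans (by simp_rw [h]; exact (key ν inferInstance).symm)
  exact (measureReal_eq_measureReal_iff).mp this

/-- The conditional mean of the spin at time `n` given the past. -/
noncomputable def drift (a : ℕ → ℝ) (n : ℤ) (x : ℤ → Fin 2) : ℝ :=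
  ∑' k : ℕ, a k * spin (x (n - (k : ℤ)))

section Moments

variable {a : ℕ → ℝ}

theorem continuous_drift (ha : Summable fun k => |a k|) (n : ℤ) : Continuous (drift a n) :=
  continuous_tsum (fun k => continuous_const.mul (continuous_spin.comp (continuous_apply _))) ha
    fun k x => by simp [abs_spin]

theorem abs_drift_le (ha : HasSum (fun k => |a k|) 1) (n : ℤ) (x : ℤ → Fin 2) :
    |drift a n x| ≤ 1 :=
  tsum_of_norm_bounded (E := ℝ) (f := fun k : ℕ => a k * spin (x (n - (k : ℤ)))) ha
    fun k => by simp [abs_spin]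

theorem integrable_of_continuous_of_bound {u : (ℤ → Fin 2) → ℝ} (hu : Continuous u)
    {C : ℝ} (hC : ∀ x, |u x| ≤ C) (μ : Measure (ℤ → Fin 2)) [IsFiniteMeasure μ] :
    Integrable u μ :=
  Integrable.of_bound hu.measurable.aestronglyMeasurable C
    (Filter.Eventually.of_forall hC)

theorem hasSum_integral_character_mul_drift (ha : Summable fun k => |a k|)
    (μ : Measure (ℤ → Fin 2)) [IsProbabilityMeasure μ] (T : Finset ℤ) (n : ℤ) :
    HasSum (fun k : ℕ => a k * ∫ x, character (symmDiff T {n - (k : ℤ)}) x ∂μ)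
      (∫ x, character T x * drift a n x ∂μ) := by
  have h := hasSum_integral_of_summable_integral_norm (μ := μ)
    (F := fun (k : ℕ) x => a k * character (symmDiff T {n - (k : ℤ)}) x)
    (fun k => (integrable_character _ μ).const_mul _)
    (by simpa [abs_mul, abs_character] using ha)
  simp_rw [integral_const_mul] at h
  suffices e : ∀ x, character T x * drift a n x
      = ∑' k : ℕ, a k * character (symmDiff T {n - (k : ℤ)}) x by simpa only [e] using h
  intro x
  rw [drift, ← tsum_mul_left]
  exact tsum_congr fun k => by rw [← character_mul_spin]; ring

theorem momentRelation_iff (ha : Summable fun k => |a k|)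
    (μ : Measure (ℤ → Fin 2)) [IsProbabilityMeasure μ] (n : ℤ) :
    MomentRelation a (fun S => ∫ x, character S x ∂μ) n ↔
      ∀ T : Finset ℤ, (∀ t ∈ T, t < n) →
        ∫ x, character (insert n T) x ∂μ = ∫ x, character T x * drift a n x ∂μ :=
  forall₂_congr fun T _ =>
    ⟨fun h => h.unique (hasSum_integral_character_mul_drift ha μ T n),
      fun h => by
        have := hasSum_integral_character_mul_drift ha μ T n
        rwa [← h] at this⟩

/-- The restriction of a configuration to the past of `n`. -/
def pastRestrict (n : ℤ) (x : ℤ → Fin 2) : {m : ℤ // m < n} → Fin 2 := fun m => x m.1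

theorem measurable_pastRestrict (n : ℤ) : Measurable (pastRestrict n) :=
  measurable_pi_lambda _ fun m => measurable_pi_apply m.1

theorem pastMeasurable_iff {n : ℤ} {E : Set (ℤ → Fin 2)} :
    PastMeasurable n E ↔ ∃ F, MeasurableSet F ∧ pastRestrict n ⁻¹' F = E := Iff.rfl

theorem PastMeasurable.measurableSet {n : ℤ} {E : Set (ℤ → Fin 2)} (hE : PastMeasurable n E) :
    MeasurableSet E := by
  obtain ⟨F, hF, rfl⟩ := pastMeasurable_iff.mp hE
  exact measurable_pastRestrict n hF

theorem character_pastRestrict {n : ℤ} (T : Finset {m : ℤ // m < n}) (x : ℤ → Fin 2) :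
    character T (pastRestrict n x) = character (T.map (Function.Embedding.subtype _)) x := by
  simp [character, pastRestrict, Finset.prod_map]

theorem pastMeasurable_character_eq {n : ℤ} {T : Finset ℤ} (hT : ∀ t ∈ T, t < n) :
    PastMeasurable n {x | character T x = 1} := by
  refine pastMeasurable_iff.mpr ⟨{y | character (T.subtype (· < n)) y = 1},
    measurable_character _ (measurableSet_singleton 1), ?_⟩
  ext x
  simp only [Set.mem_preimage, Set.mem_ofPred_eq, character_pastRestrict]
  rw [Finset.subtype_map_of_mem hT]

theorem measure_inter_coord_toReal (μ : Measure (ℤ → Fin 2)) [IsProbabilityMeasure μ]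
    (E : Set (ℤ → Fin 2)) (n : ℤ) (g : Fin 2) :
    (μ (E ∩ {x | x n = g})).toReal = ∫ x in E, (1 + spin g * spin (x n)) / 2 ∂μ := by
  have hG : MeasurableSet {x : ℤ → Fin 2 | x n = g} :=
    (measurable_pi_apply (X := fun _ : ℤ => Fin 2) n) (measurableSet_singleton g)
  have : (fun x : ℤ → Fin 2 => (1 + spin g * spin (x n)) / 2)
      = Set.indicator {x | x n = g} 1 := by
    ext x
    rw [Set.indicator_apply]
    simp only [Set.mem_ofPred_eq, Pi.one_apply]
    generalize x n = u
    fin_cases u <;> fin_cases g <;> norm_num [spin]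
  rw [this, integral_indicator_one hG, measureReal_restrict_apply hG, Set.inter_comm]
  rfl

theorem integral_character_mul_eq_zero (μ : Measure (ℤ → Fin 2)) [IsProbabilityMeasure μ]
    {n : ℤ} {f : (ℤ → Fin 2) → ℝ} (hf : Integrable f μ)
    (h : ∀ E, PastMeasurable n E → ∫ x in E, f x ∂μ = 0)
    {T : Finset ℤ} (hT : ∀ t ∈ T, t < n) : ∫ x, character T x * f x ∂μ = 0 := by
  set E := {x : ℤ → Fin 2 | character T x = 1}
  have hE : PastMeasurable n E := pastMeasurable_character_eq hT
  have hEc : PastMeasurable n Eᶜ := MeasurableSet.compl hE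
  have hint : Integrable (fun x => character T x * f x) μ :=
    hf.bdd_mul (measurable_character T).aestronglyMeasurable
      (c := 1) (Filter.Eventually.of_forall fun x => by simp [abs_character])
  rw [← integral_add_compl hE.measurableSet hint]
  have h1 : ∫ x in E, character T x * f x ∂μ = ∫ x in E, f x ∂μ :=
    setIntegral_congr_fun hE.measurableSet fun x hx => by
      simp only [show character T x = 1 from hx, one_mul]
  have h2 : ∫ x in Eᶜ, character T x * f x ∂μ = ∫ x in Eᶜ, - f x ∂μ :=
    setIntegral_congr_fun hEc.measurableSet fun x hx => by
      simp only [(character_eq_or T x).resolve_left hx, neg_mul, one_mul]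
  rw [h1, h2, integral_neg, h E hE, h _ hEc]
  simp

theorem setIntegral_eq_of_integral_character (μ : Measure (ℤ → Fin 2)) [IsProbabilityMeasure μ]
    {n : ℤ} {u v : (ℤ → Fin 2) → ℝ} (hu : Continuous u) (hv : Continuous v)
    (hu0 : ∀ x, 0 ≤ u x) (hv0 : ∀ x, 0 ≤ v x) {C : ℝ} (huC : ∀ x, |u x| ≤ C)
    (hvC : ∀ x, |v x| ≤ C)
    (h : ∀ T : Finset ℤ, (∀ t ∈ T, t < n) →
      ∫ x, character T x * u x ∂μ = ∫ x, character T x * v x ∂μ)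
    {E : Set (ℤ → Fin 2)} (hE : PastMeasurable n E) :
    ∫ x in E, u x ∂μ = ∫ x in E, v x ∂μ := by
  obtain ⟨F, hF, rfl⟩ := pastMeasurable_iff.mp hE
  have hr := measurable_pastRestrict n
  have fin : ∀ w : (ℤ → Fin 2) → ℝ, Continuous w → (∀ x, |w x| ≤ C) →
      IsFiniteMeasure ((μ.withDensity fun x => ENNReal.ofReal (w x)).map (pastRestrict n)) := by
    intro w hw hwC
    have := isFiniteMeasure_withDensity_ofReal
      (integrable_of_continuous_of_bound hw hwC μ).hasFiniteIntegral
    infer_instance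
  have int : ∀ w : (ℤ → Fin 2) → ℝ, Continuous w → (∀ x, 0 ≤ w x) →
      ∀ T, ∫ y, character T y ∂((μ.withDensity fun x => ENNReal.ofReal (w x)).map
        (pastRestrict n))
      = ∫ x, character (T.map (Function.Embedding.subtype _)) x * w x ∂μ := by
    intro w hw hw0 T
    rw [integral_map hr.aemeasurable (measurable_character T).aestronglyMeasurable,
      integral_withDensity_eq_integral_toReal_smul hw.measurable.ennreal_ofReal
        (Filter.Eventually.of_forall fun x => ENNReal.ofReal_lt_top)]
    refine integral_congr_ae (Filter.Eventually.of_forall fun x => ?_)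
    simp only [ENNReal.toReal_ofReal (hw0 x), smul_eq_mul, character_pastRestrict, mul_comm]
  have val : ∀ w : (ℤ → Fin 2) → ℝ, Continuous w → (∀ x, 0 ≤ w x) → (∀ x, |w x| ≤ C) →
      ∫ x in pastRestrict n ⁻¹' F, w x ∂μ
      = (((μ.withDensity fun x => ENNReal.ofReal (w x)).map (pastRestrict n)) F).toReal := by
    intro w hw hw0 hwC
    rw [Measure.map_apply hr hF, withDensity_apply _ (hr hF),
      integral_eq_lintegral_of_nonneg_ae (Filter.Eventually.of_forall hw0)
        hw.measurable.aestronglyMeasurable]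
  have := fin u hu huC
  have := fin v hv hvC
  rw [val u hu hu0 huC, val v hv hv0 hvC]
  congr 2
  refine measure_ext_of_integral_character fun T => ?_
  rw [int u hu hu0, int v hv hv0]
  exact h _ fun t ht => by
    obtain ⟨s, -, rfl⟩ := Finset.mem_map.mp ht
    exact s.2

theorem compatible_iff_momentRelation {θ : ℕ → ℝ} {P : ℕ → Fin 2 → Fin 2 → ℝ}
    (ha : HasSum (fun k => |a k|) 1)
    (hker : ∀ (n : ℤ) (x : ℤ → Fin 2) (g : Fin 2),
      ∑' k : ℕ, θ k * P k (x (n - (k : ℤ))) g = (1 + spin g * drift a n x) / 2)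
    (μ : Measure (ℤ → Fin 2)) [IsProbabilityMeasure μ] :
    Compatible θ P μ ↔ ∀ n, MomentRelation a (fun S => ∫ x, character S x ∂μ) n := by
  simp only [momentRelation_iff ha.summable]
  have hcs : ∀ n : ℤ, Continuous fun x : ℤ → Fin 2 => spin (x n) := fun n =>
    continuous_spin.comp (continuous_apply n)
  have hcd := continuous_drift ha.summable
  have his : ∀ n : ℤ, Integrable (fun x : ℤ → Fin 2 => spin (x n)) μ := fun n =>
    integrable_of_continuous_of_bound (hcs n) (fun x => (abs_spin _).le) μ
  have hid : ∀ n : ℤ, Integrable (drift a n) μ := fun n =>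
    integrable_of_continuous_of_bound (hcd n) (abs_drift_le ha n) μ
  have hbdd : ∀ (T : Finset ℤ) {f : (ℤ → Fin 2) → ℝ}, Integrable f μ →
      Integrable (fun x => character T x * f x) μ := fun T f hf =>
    hf.bdd_mul (measurable_character T).aestronglyMeasurable
      (c := 1) (Filter.Eventually.of_forall fun x => by simp [abs_character])
  have hins : ∀ (n : ℤ) (T : Finset ℤ), (∀ t ∈ T, t < n) →
      ∫ x, character (insert n T) x ∂μ = ∫ x, character T x * spin (x n) ∂μ := fun n T hT => by
    simp_rw [character_insert (fun hn => lt_irrefl n (hT n hn))]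
  constructor
  · intro hμ n T hT
    rw [hins n T hT, ← sub_eq_zero, ← integral_sub (hbdd T (his n)) (hbdd T (hid n))]
    simp_rw [← mul_sub]
    refine integral_character_mul_eq_zero μ ((his n).sub (hid n)) (fun E hE => ?_) hT
    have h1 := hμ n 0 E hE
    rw [measure_inter_coord_toReal μ] at h1
    simp_rw [hker, show spin 0 = 1 from rfl, one_mul] at h1
    simp_rw [add_div] at h1
    rw [integral_add (integrable_const _) ((his n).div_const 2).integrableOn,
      integral_add (integrable_const _) ((hid n).div_const 2).integrableOn,
      integral_div] at h1
    simp only [integral_div] at h1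
    simp only [Pi.sub_apply]
    rw [integral_sub (his n).integrableOn (hid n).integrableOn]
    linarith
  · intro h n g E hE
    rw [measure_inter_coord_toReal μ]
    simp_rw [hker]
    have hb : ∀ s : ℝ, |s| ≤ 1 → 0 ≤ (1 + spin g * s) / 2 ∧ |(1 + spin g * s) / 2| ≤ 1 := by
      intro s hs
      have : |spin g * s| ≤ 1 := by rw [abs_mul, abs_spin, one_mul]; exact hs
      rw [abs_le] at this
      exact ⟨by linarith, abs_le.mpr ⟨by linarith, by linarith⟩⟩
    refine setIntegral_eq_of_integral_character μ (u := fun x => (1 + spin g * spin (x n)) / 2)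
      (v := fun x => (1 + spin g * drift a n x) / 2)
      ((continuous_const.add (continuous_const.mul (hcs n))).div_const 2)
      ((continuous_const.add (continuous_const.mul (hcd n))).div_const 2)
      (fun x => (hb _ (abs_spin _).le).1) (fun x => (hb _ (abs_drift_le ha n x)).1)
      (fun x => (hb _ (abs_spin _).le).2) (fun x => (hb _ (abs_drift_le ha n x)).2)
      (fun T hT => ?_) hE
    have expand : ∀ f : (ℤ → Fin 2) → ℝ, Integrable f μ →
        ∫ x, character T x * ((1 + spin g * f x) / 2) ∂μ
          = (∫ x, character T x ∂μ + spin g * ∫ x, character T x * f x ∂μ) / 2 := by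
      intro f hf
      rw [← integral_const_mul, ← integral_add (integrable_character T μ)
        ((hbdd T hf).const_mul _), ← integral_div]
      exact integral_congr_ae (Filter.Eventually.of_forall fun x => by simp only; ring)
    rw [expand _ (his n), expand _ (hid n), ← hins n T hT, h n T hT]

end Moments

section Existence

variable {θ ε : ℕ → ℝ}

/-- The configuration obtained by letting the spin at time `n` imitate the one at time `n - k`,
up to a flip if `ε k ≠ 1`. -/
noncomputable def imitate (ε : ℕ → ℝ) (n : ℤ) (k : ℕ) (x : ℤ → Fin 2) : ℤ → Fin 2 :=
  Function.update x n (if ε k = 1 then x (n - (k : ℤ)) else 1 - x (n - (k : ℤ)))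

theorem measurable_imitate (n : ℤ) (k : ℕ) : Measurable (imitate ε n k) := by
  refine measurable_pi_lambda _ fun m => ?_
  have hm : Measurable fun x : ℤ → Fin 2 => x (n - (k : ℤ)) := measurable_pi_apply _
  by_cases h : m = n
  · subst h
    by_cases hk : ε k = 1
    · simpa [imitate, hk] using hm
    · simpa [imitate, hk, Function.comp_def] using
        (measurable_of_finite (fun i : Fin 2 => 1 - i)).comp hm
  · simpa [imitate, Function.update_of_ne h] using measurable_pi_apply (X := fun _ => Fin 2) m

theorem spin_imitate (hε : ∀ k, ε k = 1 ∨ ε k = -1) (n : ℤ) (k : ℕ) (x : ℤ → Fin 2) :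
    spin (imitate ε n k x n) = ε k * spin (x (n - (k : ℤ))) := by
  simp only [imitate, Function.update_self]
  generalize x (n - (k : ℤ)) = u
  rcases hε k with h | h <;> rw [h] <;> fin_cases u <;> norm_num [spin]

theorem character_imitate {n : ℤ} {S : Finset ℤ} (hS : n ∉ S) (k : ℕ) (x : ℤ → Fin 2) :
    character S (imitate ε n k x) = character S x :=
  Finset.prod_congr rfl fun s hs => by
    rw [imitate, Function.update_of_ne (ne_of_mem_of_not_mem hs hS)]

theorem character_insert_imitate (hε : ∀ k, ε k = 1 ∨ ε k = -1) {n : ℤ} {T : Finset ℤ}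
    (hT : n ∉ T) (k : ℕ) (x : ℤ → Fin 2) :
    character (insert n T) (imitate ε n k x)
      = ε k * character (symmDiff T {n - (k : ℤ)}) x := by
  rw [character_insert hT, character_imitate hT, spin_imitate hε, ← character_mul_spin]
  ring

/-- The law of the configuration after resampling the spin at time `n`. -/
noncomputable def resample (θ ε : ℕ → ℝ) (n : ℤ) (μ : Measure (ℤ → Fin 2)) :
    Measure (ℤ → Fin 2) :=
  Measure.sum fun k => ENNReal.ofReal (θ k) • μ.map (imitate ε n k)

theorem isProbabilityMeasure_resample (hθnn : ∀ k, 0 ≤ θ k) (hθsum : HasSum θ 1) (n : ℤ)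
    (μ : Measure (ℤ → Fin 2)) [IsProbabilityMeasure μ] :
    IsProbabilityMeasure (resample θ ε n μ) := by
  constructor
  rw [resample, Measure.sum_apply _ MeasurableSet.univ]
  have : ∀ k, (ENNReal.ofReal (θ k) • μ.map (imitate ε n k)) Set.univ = ENNReal.ofReal (θ k) := by
    intro k
    rw [Measure.smul_apply, Measure.map_apply (measurable_imitate n k) MeasurableSet.univ]
    simp
  simp_rw [this]
  rw [← ENNReal.ofReal_tsum_of_nonneg hθnn hθsum.summable, hθsum.tsum_eq, ENNReal.ofReal_one]

theorem hasSum_integral_resample (hθnn : ∀ k, 0 ≤ θ k) (hθsum : HasSum θ 1) (n : ℤ)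
    (μ : Measure (ℤ → Fin 2)) [IsProbabilityMeasure μ] (S : Finset ℤ) :
    HasSum (fun k => θ k * ∫ x, character S (imitate ε n k x) ∂μ)
      (∫ x, character S x ∂(resample θ ε n μ)) := by
  have := isProbabilityMeasure_resample (ε := ε) hθnn hθsum n μ
  have h := hasSum_integral_measure (f := character S)
    (μ := fun k => ENNReal.ofReal (θ k) • μ.map (imitate ε n k))
    (integrable_character S (resample θ ε n μ))
  refine h.congr_fun fun k => ?_
  rw [integral_smul_measure, ENNReal.toReal_ofReal (hθnn k), smul_eq_mul,
    integral_map (measurable_imitate n k).aemeasurable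
      (measurable_character S).aestronglyMeasurable]

theorem integral_character_resample (hθnn : ∀ k, 0 ≤ θ k) (hθsum : HasSum θ 1) {n : ℤ}
    (μ : Measure (ℤ → Fin 2)) [IsProbabilityMeasure μ] {S : Finset ℤ} (hS : n ∉ S) :
    ∫ x, character S x ∂(resample θ ε n μ) = ∫ x, character S x ∂μ := by
  have h := hasSum_integral_resample (ε := ε) hθnn hθsum n μ S
  simp_rw [character_imitate hS] at h
  simpa using h.unique (hθsum.mul_right _)

theorem momentRelation_resample_self (hApos : ∀ k, θ k ≠ 0 → 0 < k)
    (hθnn : ∀ k, 0 ≤ θ k) (hθsum : HasSum θ 1) (hε : ∀ k, ε k = 1 ∨ ε k = -1) (n : ℤ)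
    (μ : Measure (ℤ → Fin 2)) [IsProbabilityMeasure μ] :
    MomentRelation (fun k => θ k * ε k) (fun S => ∫ x, character S x ∂(resample θ ε n μ)) n := by
  intro T hT
  have hnT : n ∉ T := fun h => lt_irrefl n (hT n h)
  have h := hasSum_integral_resample (ε := ε) hθnn hθsum n μ (insert n T)
  simp_rw [character_insert_imitate hε hnT, integral_const_mul] at h
  suffices e : ∀ k : ℕ, θ k * ε k *
      ∫ x, character (symmDiff T {n - (k : ℤ)}) x ∂(resample θ ε n μ)
      = θ k * (ε k * ∫ x, character (symmDiff T {n - (k : ℤ)}) x ∂μ) by simpa only [e] using h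
  intro k
  by_cases hk : θ k = 0
  · simp [hk]
  · have := hApos k hk
    rw [integral_character_resample hθnn hθsum μ, mul_assoc]
    rw [Finset.mem_symmDiff, Finset.mem_singleton]
    rintro (⟨h, -⟩ | ⟨h, -⟩)
    · exact hnT h
    · omega

theorem momentRelation_resample_of_lt (hApos : ∀ k, θ k ≠ 0 → 0 < k)
    (hθnn : ∀ k, 0 ≤ θ k) (hθsum : HasSum θ 1) {m n : ℤ} (hmn : m < n)
    {μ : Measure (ℤ → Fin 2)} [IsProbabilityMeasure μ]
    (h : MomentRelation (fun k => θ k * ε k) (fun S => ∫ x, character S x ∂μ) m) :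
    MomentRelation (fun k => θ k * ε k) (fun S => ∫ x, character S x ∂(resample θ ε n μ)) m := by
  intro T hT
  have h1 := h T hT
  have hnT : n ∉ T := fun h => by have := hT n h; omega
  simp only at h1 ⊢
  rw [integral_character_resample hθnn hθsum μ (by simp [hnT, hmn.ne'])]
  suffices e : ∀ k : ℕ, θ k * ε k *
      ∫ x, character (symmDiff T {m - (k : ℤ)}) x ∂(resample θ ε n μ)
      = θ k * ε k * ∫ x, character (symmDiff T {m - (k : ℤ)}) x ∂μ by simpa only [e] using h1
  intro k
  by_cases hk : θ k = 0
  · simp [hk]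
  · have := hApos k hk
    rw [integral_character_resample hθnn hθsum μ]
    rw [Finset.mem_symmDiff, Finset.mem_singleton]
    rintro (⟨h, -⟩ | ⟨h, -⟩)
    · exact hnT h
    · omega

theorem exists_momentRelation_of_lt (hApos : ∀ k, θ k ≠ 0 → 0 < k)
    (hθnn : ∀ k, 0 ≤ θ k) (hθsum : HasSum θ 1) (hε : ∀ k, ε k = 1 ∨ ε k = -1) (l : ℤ) (j : ℕ) :
    ∃ μ : ProbabilityMeasure (ℤ → Fin 2), ∀ n, l ≤ n → n < l + j →
      MomentRelation (fun k => θ k * ε k)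
        (fun S => ∫ x, character S x ∂(μ : Measure (ℤ → Fin 2))) n := by
  induction j with
  | zero => exact ⟨⟨Measure.dirac 0, inferInstance⟩, fun n h1 h2 => by simp at h2; omega⟩
  | succ j ih =>
    obtain ⟨μ, hμ⟩ := ih
    refine ⟨⟨resample θ ε (l + j) μ, isProbabilityMeasure_resample hθnn hθsum _ _⟩,
      fun n h1 h2 => ?_⟩
    rcases lt_or_ge n (l + j) with hn | hn
    · exact momentRelation_resample_of_lt hApos hθnn hθsum hn (hμ n h1 hn)
    · obtain rfl : n = l + j := by push_cast at h2; omega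
      exact momentRelation_resample_self hApos hθnn hθsum hε _ _

theorem isClosed_setOf_momentRelation (hθnn : ∀ k, 0 ≤ θ k) (hθsum : HasSum θ 1)
    (hε : ∀ k, ε k = 1 ∨ ε k = -1) (n : ℤ) :
    IsClosed {μ : ProbabilityMeasure (ℤ → Fin 2) | MomentRelation (fun k => θ k * ε k)
        (fun S => ∫ x, character S x ∂(μ : Measure (ℤ → Fin 2))) n} := by
  have ha : HasSum (fun k => |θ k * ε k|) 1 := by simpa only [abs_weight hθnn hε] using hθsum
  have hcont : ∀ f : (ℤ → Fin 2) → ℝ, Continuous f →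
      Continuous fun μ : ProbabilityMeasure (ℤ → Fin 2) =>
        ∫ x, f x ∂(μ : Measure (ℤ → Fin 2)) := fun f hf =>
    ProbabilityMeasure.continuous_integral_boundedContinuousFunction
      (BoundedContinuousFunction.mkOfCompact ⟨f, hf⟩)
  simp only [momentRelation_iff ha.summable, Set.ofPred_forall]
  exact isClosed_iInter fun T => isClosed_iInter fun _ => isClosed_eq
    (hcont _ (continuous_character _))
    (hcont _ ((continuous_character T).mul (continuous_drift ha.summable n)))

theorem exists_momentRelation (hApos : ∀ k, θ k ≠ 0 → 0 < k)
    (hθnn : ∀ k, 0 ≤ θ k) (hθsum : HasSum θ 1) (hε : ∀ k, ε k = 1 ∨ ε k = -1) :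
    ∃ μ : ProbabilityMeasure (ℤ → Fin 2), ∀ n,
      MomentRelation (fun k => θ k * ε k)
        (fun S => ∫ x, character S x ∂(μ : Measure (ℤ → Fin 2))) n := by
  let K : ℕ → Set (ProbabilityMeasure (ℤ → Fin 2)) := fun j =>
    ⋂ n ∈ Set.Ico (-(j : ℤ)) j, {μ | MomentRelation (fun k => θ k * ε k)
        (fun S => ∫ x, character S x ∂(μ : Measure (ℤ → Fin 2))) n}
  have hclosed : ∀ j, IsClosed (K j) := fun j =>
    isClosed_biInter fun n _ => isClosed_setOf_momentRelation hθnn hθsum hε n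
  have hne : ∀ j, (K j).Nonempty := fun j => by
    obtain ⟨μ, hμ⟩ := exists_momentRelation_of_lt hApos hθnn hθsum hε (-(j : ℤ)) (2 * j)
    exact ⟨μ, Set.mem_iInter₂.mpr fun n hn => hμ n hn.1 (by have := hn.2; push_cast; omega)⟩
  obtain ⟨μ, hμ⟩ := IsCompact.nonempty_iInter_of_sequence_nonempty_isCompact_isClosed K
    (fun j => Set.biInter_mono (fun n hn => ⟨by have := hn.1; push_cast; omega,
      by have := hn.2; push_cast; omega⟩) fun _ _ => le_rfl) hne (hclosed 0).isCompact hclosed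
  refine ⟨μ, fun n => ?_⟩
  exact Set.mem_iInter₂.mp (Set.mem_iInter.mp hμ (n.natAbs + 1)) n ⟨by omega, by omega⟩

end Existence

section Sign

variable {A : Set ℕ} {θ ε : ℕ → ℝ} {P : ℕ → Fin 2 → Fin 2 → ℝ}

theorem tsum_kernel_eq (hθnn : ∀ k, 0 ≤ θ k) (hθsum : HasSum θ 1)
    (hε : ∀ k, ε k = 1 ∨ ε k = -1)
    (hP : ∀ k i g, θ k * P k i g = θ k * ((1 + spin g * (ε k * spin i)) / 2))
    (n : ℤ) (x : ℤ → Fin 2) (g : Fin 2) :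
    ∑' k : ℕ, θ k * P k (x (n - (k : ℤ))) g
      = (1 + spin g * drift (fun k => θ k * ε k) n x) / 2 := by
  have hs : Summable fun k : ℕ => θ k * ε k * spin (x (n - (k : ℤ))) := by
    refine Summable.of_norm ?_
    simpa only [Real.norm_eq_abs, abs_mul _ (spin _), abs_spin, mul_one, abs_weight hθnn hε]
      using hθsum.summable
  have h := (hθsum.add (hs.hasSum.mul_left (spin g))).div_const 2
  refine Eq.trans (tsum_congr fun k => ?_) h.tsum_eq
  rw [hP]; ring

theorem momentRelation_dirac (hθsum : HasSum θ 1) (ha : Summable fun k => |θ k * ε k|)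
    {x : ℤ → Fin 2}
    (hx : ∀ k n, θ k * (ε k * spin (x (n - (k : ℤ)))) = θ k * spin (x n)) (n : ℤ) :
    MomentRelation (fun k => θ k * ε k)
      (fun S => ∫ y, character S y ∂(Measure.dirac x)) n := by
  rw [momentRelation_iff ha]
  intro T hT
  have hd : drift (fun k => θ k * ε k) n x = spin (x n) := by
    simp only [drift, mul_assoc, hx]
    rw [(hθsum.mul_right (spin (x n))).tsum_eq, one_mul]
  rw [integral_dirac, integral_dirac, hd, character_insert fun h => lt_irrefl n (hT n h)]

theorem spin_one_sub (i : Fin 2) : spin (1 - i) = - spin i := by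
  fin_cases i <;> norm_num [spin]

theorem not_existsUnique_of_dirac (hθnn : ∀ k, 0 ≤ θ k) (hθsum : HasSum θ 1)
    (hε : ∀ k, ε k = 1 ∨ ε k = -1)
    (hP : ∀ k i g, θ k * P k i g = θ k * ((1 + spin g * (ε k * spin i)) / 2))
    {x : ℤ → Fin 2}
    (hx : ∀ k n, θ k * (ε k * spin (x (n - (k : ℤ)))) = θ k * spin (x n)) :
    ¬ ∃! μ : Measure (ℤ → Fin 2), IsProbabilityMeasure μ ∧ Compatible θ P μ := by
  rintro ⟨μ, -, huniq⟩
  have ha : HasSum (fun k => |θ k * ε k|) 1 := by simpa only [abs_weight hθnn hε] using hθsum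
  have hdirac : ∀ y : ℤ → Fin 2,
      (∀ k n, θ k * (ε k * spin (y (n - (k : ℤ)))) = θ k * spin (y n)) →
      Measure.dirac y = μ := fun y hy =>
    huniq _ ⟨inferInstance, (compatible_iff_momentRelation ha
      (tsum_kernel_eq hθnn hθsum hε hP) _).mpr (momentRelation_dirac hθsum ha.summable hy)⟩
  have h1 := (hdirac x hx).trans (hdirac (fun n => 1 - x n) fun k n => by
    simp only [spin_one_sub]
    linear_combination - hx k n).symm
  have h2 : x 0 = 1 - x 0 := congrFun (dirac_eq_dirac_iff.mp h1) 0
  generalize x 0 = u at h2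
  fin_cases u <;> simp at h2

theorem existsUnique_of_opposite_signs (hApos : ∀ k ∈ A, 0 < k)
    (hθpos : ∀ k ∈ A, 0 < θ k) (hθ0 : ∀ k, k ∉ A → θ k = 0) (hθsum : HasSum θ 1)
    (hε : ∀ k, ε k = 1 ∨ ε k = -1)
    (hP : ∀ k i g, θ k * P k i g = θ k * ((1 + spin g * (ε k * spin i)) / 2))
    (hgcd : Nat.setGcd A = 1)
    {k k' j j' : ℕ} (hk : k ∈ A) (hk' : k' ∈ A) (hkj : k * j = k' * j')
    (hεk : ε k ^ j = 1) (hεk' : ε k' ^ j' = -1) :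
    ∃! μ : Measure (ℤ → Fin 2), IsProbabilityMeasure μ ∧ Compatible θ P μ := by
  have hθnn : ∀ k, 0 ≤ θ k := fun k => by
    by_cases h : k ∈ A
    · exact (hθpos k h).le
    · exact (hθ0 k h).ge
  have hApos' : ∀ k, θ k ≠ 0 → 0 < k := fun k h => hApos k (by_contra fun h' => h (hθ0 k h'))
  have ha : HasSum (fun k => |θ k * ε k|) 1 := by simpa only [abs_weight hθnn hε] using hθsum
  have hker := tsum_kernel_eq hθnn hθsum hε hP
  obtain ⟨N, hN⟩ := Nat.exists_mem_closure_of_ge A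
  obtain ⟨μ, hμ⟩ := exists_momentRelation hApos' hθnn hθsum hε
  refine ⟨μ, ⟨inferInstance, (compatible_iff_momentRelation ha hker _).mpr hμ⟩, ?_⟩
  rintro ν ⟨hν1, hν⟩
  rw [compatible_iff_momentRelation ha hker] at hν
  refine measure_ext_of_integral_character fun S => ?_
  have := eq_zero_of_momentRelation
    (h := fun S => ∫ x, character S x ∂ν - ∫ x, character S x ∂(μ : Measure (ℤ → Fin 2)))
    hApos hθpos hθnn hθsum hε (fun m hm => hN m hm (hgcd ▸ one_dvd m)) hk hk' hkj hεk hεk'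
    (fun n T hT => by
      have h := (hν n T hT).sub (hμ n T hT)
      simpa only [← mul_sub] using h)
    (by simp [character]) (B := 2)
    (fun S => by
      have h1 := abs_integral_character_le S ν
      have h2 := abs_integral_character_le S (μ : Measure (ℤ → Fin 2))
      exact (abs_sub _ _).trans (by linarith)) S
  exact sub_eq_zero.mp this

end Sign

/-- binary autoregressive kernels, `P_(k) ∈ {I₂, J₂}`,
`gcd(A) = 1`: uniqueness holds iff there is an even `m ∈ A` with `P_(m) = J₂`,
or two odd `m₁, m₂ ∈ A` with `P_(m₁) = J₂` and `P_(m₂) = I₂`. -/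
theorem stmt_16
    (A : Set ℕ) (hA : A.Nonempty) (hApos : ∀ k ∈ A, 0 < k)
    (θ : ℕ → ℝ) (hθpos : ∀ k ∈ A, 0 < θ k) (hθ0 : ∀ k, k ∉ A → θ k = 0)
    (hθsum : HasSum θ 1)
    (P : ℕ → Fin 2 → Fin 2 → ℝ)
    (hrange : ∀ k ∈ A,
      (P k = fun i j => if i = j then (1 : ℝ) else 0) ∨
      (P k = fun i j => if i = j then (0 : ℝ) else 1))
    (hgcdA : IsGCDOfSet A 1) :
    (∃! μ : Measure (ℤ → Fin 2), IsProbabilityMeasure μ ∧ Compatible θ P μ) ↔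
      ((∃ m ∈ A, Even m ∧ P m = fun i j => if i = j then (0 : ℝ) else 1) ∨
       (∃ m₁ ∈ A, ∃ m₂ ∈ A, Odd m₁ ∧ Odd m₂ ∧
         (P m₁ = fun i j => if i = j then (0 : ℝ) else 1) ∧
         (P m₂ = fun i j => if i = j then (1 : ℝ) else 0))) := by
  have hθnn : ∀ k, 0 ≤ θ k := fun k => by
    by_cases h : k ∈ A
    · exact (hθpos k h).le
    · exact (hθ0 k h).ge
  have hIJ : (fun i j : Fin 2 => if i = j then (0 : ℝ) else 1)
      ≠ fun i j => if i = j then (1 : ℝ) else 0 := fun h => by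
    simpa using congrFun (congrFun h 0) 0
  obtain ⟨ε, hεdef⟩ : ∃ ε : ℕ → ℝ, ∀ k, ε k =
      if P k = fun i j => if i = j then (1 : ℝ) else 0 then 1 else -1 := by
    classical exact ⟨_, fun _ => rfl⟩
  have hε : ∀ k, ε k = 1 ∨ ε k = -1 := fun k => by
    rw [hεdef]; split_ifs <;> simp
  have hεI : ∀ k, (P k = fun i j => if i = j then (1 : ℝ) else 0) → ε k = 1 := fun k h => by
    rw [hεdef, if_pos h]
  have hεJ : ∀ k, (P k = fun i j => if i = j then (0 : ℝ) else 1) → ε k = -1 := fun k h => by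
    rw [hεdef, if_neg (h ▸ hIJ)]
  have hP : ∀ k i g, θ k * P k i g = θ k * ((1 + spin g * (ε k * spin i)) / 2) := by
    intro k i g
    by_cases hk : k ∈ A
    · congr 1
      rcases hrange k hk with h | h
      · rw [hεI k h, h]
        fin_cases i <;> fin_cases g <;> norm_num [spin]
      · rw [hεJ k h, h]
        fin_cases i <;> fin_cases g <;> norm_num [spin]
    · simp [hθ0 k hk]
  have hgcd : Nat.setGcd A = 1 :=
    Nat.dvd_one.mp (hgcdA.2 _ fun n hn => Nat.setGcd_dvd_of_mem hn)
  constructor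
  · intro hex
    by_contra hcon
    push Not at hcon
    obtain ⟨heven, hodd⟩ := hcon
    have hevenI : ∀ k ∈ A, Even k → ε k = 1 := fun k hk he =>
      hεI k ((hrange k hk).resolve_right (heven k hk he))
    by_cases hJ : ∃ m ∈ A, Odd m ∧ P m = fun i j => if i = j then (0 : ℝ) else 1
    · obtain ⟨m, hm, hmo, hmJ⟩ := hJ
      refine not_existsUnique_of_dirac hθnn hθsum hε hP
        (x := fun n => if Even n then 0 else 1) (fun k n => ?_) hex
      by_cases hk : k ∈ A
      · congr 1
        rcases Nat.even_or_odd k with he | ho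
        · rw [hevenI k hk he, one_mul]
          have : Even (n - (k : ℤ)) ↔ Even n := by
            rw [Int.even_sub, Int.even_coe_nat]; simp [he]
          simp only [this]
        · rw [hεJ k ((hrange k hk).resolve_left (hodd m hm k hk hmo ho hmJ))]
          have : Even (n - (k : ℤ)) ↔ ¬ Even n := by
            rw [Int.even_sub, Int.even_coe_nat]; simp [Nat.not_even_iff_odd.mpr ho]
          simp only [this]
          by_cases hn : Even n <;> simp [hn, spin]
      · simp [hθ0 k hk]
    · refine not_existsUnique_of_dirac hθnn hθsum hε hP (x := fun _ => 0) (fun k n => ?_) hex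
      by_cases hk : k ∈ A
      · have : ε k = 1 := by
          rcases Nat.even_or_odd k with he | ho
          · exact hevenI k hk he
          · exact hεI k ((hrange k hk).resolve_right fun h => hJ ⟨k, hk, ho, h⟩)
        rw [this, one_mul]
      · simp [hθ0 k hk]
  · rintro (⟨m, hm, hme, hmJ⟩ | ⟨m₁, hm₁, m₂, hm₂, ho₁, ho₂, hJ, hI⟩)
    · obtain ⟨k, hk, hko⟩ : ∃ k ∈ A, Odd k := by
        by_contra hcon
        push Not at hcon
        have := hgcdA.2 2 fun n hn => (Nat.not_odd_iff_even.mp (hcon n hn)).two_dvd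
        omega
      refine existsUnique_of_opposite_signs hApos hθpos hθ0 hθsum hε hP hgcd hk hm
        (mul_comm k m) ?_ ?_
      · rcases hε k with h | h <;> simp [h, hme.neg_one_pow]
      · rw [hεJ m hmJ, hko.neg_one_pow]
    · refine existsUnique_of_opposite_signs hApos hθpos hθ0 hθsum hε hP hgcd hm₂ hm₁
        (mul_comm m₂ m₁) ?_ ?_
      · rw [hεI m₂ hI, one_pow]
      · rw [hεJ m₁ hJ, ho₂.neg_one_pow]
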